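/- arXiv:2112.04242 — 6 statements merged into one kernel-verified Lean document; each statement's English description precedes it below -/
import Mathlib

section
/- Let I and J be finite index types, let A be a complex matrix indexed by (I × J) × (I × J), and let u, v : I → ℂ. Define the matrix A₂ indexed by J × J by A₂(j, j') = Σ_{i ∈ I} Σ_{i' ∈ I} conj(u(i)) · A((i, j), (i', j')) · v(i'). Then ‖A₂‖∞ ≤ ‖A‖∞ · ‖u‖ · ‖v‖, where ‖u‖ = √(Σ_i |u(i)|²) and ‖v‖ = √(Σ_i |v(i)|²) are the Euclidean norms. -/
open scoped Matrix ComplexOrder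

open scoped Kronecker

/-- The operator norm of a complex matrix induced by the ℓ² (Euclidean) vector norm,
i.e. the largest singular value. -/
noncomputable def opNorm {m n : Type*} [Fintype m] [Fintype n] [DecidableEq n]
    (A : Matrix m n ℂ) : ℝ :=
  ‖LinearMap.toContinuousLinearMap (Matrix.toEuclideanLin A)‖

/-- The Frobenius (Hilbert–Schmidt) norm of a complex matrix: `√(tr(AᴴA))`. -/
noncomputable def frobNorm {m n : Type*} [Fintype m] [Fintype n] (A : Matrix m n ℂ) : ℝ :=
  Real.sqrt (Matrix.trace (Aᴴ * A)).re

open scoped Matrix.Norms.L2Operator in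
theorem opNorm_eq_l2_opNorm {m n : Type*} [Fintype m] [Fintype n] [DecidableEq n]
    (A : Matrix m n ℂ) : opNorm A = ‖A‖ := rfl

/-- The matrix of the map `x ↦ u ⊗ x`. -/
def tensorLeft {I : Type*} (J : Type*) [DecidableEq J] (u : I → ℂ) : Matrix (I × J) J ℂ :=
  Matrix.of fun p j => if p.2 = j then u p.1 else 0

theorem tensorLeft_conjTranspose_mul_self {I J : Type*} [Fintype I] [Fintype J] [DecidableEq J]
    (u : I → ℂ) :
    (tensorLeft J u)ᴴ * tensorLeft J u =
      Matrix.diagonal fun _ => ((∑ i, ‖u i‖ ^ 2 : ℝ) : ℂ) := by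
  ext j j'
  simp only [Matrix.mul_apply, Matrix.conjTranspose_apply, tensorLeft, Matrix.of_apply,
    Fintype.sum_prod_type, Matrix.diagonal_apply]
  by_cases h : j = j'
  · subst h
    simp [apply_ite, Complex.conj_mul']
  · simp [apply_ite, h, Ne.symm h]

open scoped Matrix.Norms.L2Operator in
theorem l2_opNorm_tensorLeft_le {I J : Type*} [Fintype I] [Fintype J] [DecidableEq J]
    (u : I → ℂ) : ‖tensorLeft J u‖ ≤ √(∑ i, ‖u i‖ ^ 2) := by
  apply Real.le_sqrt_of_sq_le
  have hu : 0 ≤ ∑ i, ‖u i‖ ^ 2 := by positivity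
  rw [sq, ← Matrix.l2_opNorm_conjTranspose_mul_self, tensorLeft_conjTranspose_mul_self,
    Matrix.l2_opNorm_diagonal, pi_norm_le_iff_of_nonneg hu]
  intro _
  rw [Complex.norm_real, Real.norm_of_nonneg hu]

theorem partialContraction_eq {I J : Type*} [Fintype I] [Fintype J] [DecidableEq J]
    (A : Matrix (I × J) (I × J) ℂ) (u v : I → ℂ) :
    (Matrix.of fun j j' : J =>
        ∑ i : I, ∑ i' : I, (starRingEnd ℂ) (u i) * A (i, j) (i', j') * v i') =
      (tensorLeft J u)ᴴ * A * tensorLeft J v := by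
  ext j j'
  simp only [Matrix.mul_apply, Matrix.conjTranspose_apply, tensorLeft, Matrix.of_apply,
    Fintype.sum_prod_type]
  simp only [apply_ite star, star_zero, ite_mul, zero_mul, mul_ite, mul_zero,
    Finset.sum_ite_eq', Finset.mem_univ, if_true, Finset.sum_mul]
  exact Finset.sum_comm

open scoped Matrix.Norms.L2Operator in
theorem opNorm_tensorLeft_compression_le {I J : Type*} [Fintype I] [Fintype J] [DecidableEq I]
    [DecidableEq J] (A : Matrix (I × J) (I × J) ℂ) (u v : I → ℂ) :
    opNorm ((tensorLeft J u)ᴴ * A * tensorLeft J v) ≤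
      opNorm A * √(∑ i, ‖u i‖ ^ 2) * √(∑ i, ‖v i‖ ^ 2) := by
  rw [opNorm_eq_l2_opNorm, opNorm_eq_l2_opNorm]
  have hu := l2_opNorm_tensorLeft_le (J := J) u
  have hv := l2_opNorm_tensorLeft_le (J := J) v
  rw [← Matrix.l2_opNorm_conjTranspose] at hu
  refine (Matrix.l2_opNorm_mul _ _).trans ?_
  refine (mul_le_mul_of_nonneg_right (Matrix.l2_opNorm_mul _ _) (norm_nonneg _)).trans ?_
  rw [mul_comm ‖(tensorLeft J u)ᴴ‖]
  gcongr

theorem stmt_8 {I J : Type*} [Fintype I] [Fintype J] [DecidableEq I] [DecidableEq J]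
    (A : Matrix (I × J) (I × J) ℂ) (u v : I → ℂ) :
    opNorm (Matrix.of fun j j' : J =>
        ∑ i : I, ∑ i' : I, (starRingEnd ℂ) (u i) * A (i, j) (i', j') * v i')
      ≤ opNorm A * Real.sqrt (∑ i, ‖u i‖ ^ 2) * Real.sqrt (∑ i, ‖v i‖ ^ 2) := by
  rw [partialContraction_eq]
  exact opNorm_tensorLeft_compression_le A u v
end

section
/- Let d₁, d₂ ≥ 1, let T be a complex matrix indexed by ((Fin d₁ × Fin d₂) × (Fin d₁ × Fin d₂)) × ((Fin d₁ × Fin d₂) × (Fin d₁ × Fin d₂)) (the matrix representation of a superoperator on a bipartite system, acting on row-vectorized operators), and let σ be a d₁×d₁ complex matrix. Define the matrix B indexed by (Fin d₂ × Fin d₂) × (Fin d₂ × Fin d₂) by B((j, j'), (b, b')) = Σ_{i} Σ_{a, a'} T(((i, j), (i, j')), ((a, b), (a', b'))) · σ(a, a'). Then ‖B‖∞ ≤ √d₁ · ‖σ‖₂ · ‖T‖∞. -/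
open scoped Matrix ComplexOrder

open scoped Kronecker

/-- The norm of `A *ᵥ x` is at most the operator norm of `A` times the norm of `x`. -/
theorem norm_mulVec_le_opNorm {m n : Type*} [Fintype m] [Fintype n] [DecidableEq n]
    (A : Matrix m n ℂ) (x : n → ℂ) :
    ‖WithLp.toLp 2 (A *ᵥ x)‖ ≤ opNorm A * ‖WithLp.toLp 2 x‖ :=
  (LinearMap.toContinuousLinearMap (Matrix.toEuclideanLin A)).le_opNorm (WithLp.toLp 2 x)

/-- A bound on `‖A *ᵥ x‖` for every `x` bounds the operator norm of `A`. -/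
theorem opNorm_le_of_norm_mulVec_le {m n : Type*} [Fintype m] [Fintype n] [DecidableEq n]
    (A : Matrix m n ℂ) {c : ℝ} (hc : 0 ≤ c)
    (h : ∀ x : n → ℂ, ‖WithLp.toLp 2 (A *ᵥ x)‖ ≤ c * ‖WithLp.toLp 2 x‖) :
    opNorm A ≤ c :=
  ContinuousLinearMap.opNorm_le_bound _ hc fun x => h x.ofLp

theorem frobNorm_sq {m n : Type*} [Fintype m] [Fintype n] (A : Matrix m n ℂ) :
    frobNorm A ^ 2 = ∑ i, ∑ j, ‖A i j‖ ^ 2 := by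
  have h : (Matrix.trace (Aᴴ * A)).re = ∑ i, ∑ j, ‖A i j‖ ^ 2 := by
    rw [Finset.sum_comm]
    simp only [Matrix.trace, Matrix.diag_apply, Matrix.mul_apply, Matrix.conjTranspose_apply,
      Complex.re_sum, Complex.star_def, Complex.conj_mul']
    norm_cast
  rw [frobNorm, h, Real.sq_sqrt (by positivity)]

/-- Pairing a matrix with a vector `x` on a doubled system, in row vectorization, multiplies
the norms. -/
theorem norm_doubled_tensor {α β : Type*} [Fintype α] [Fintype β]
    (σ : Matrix α α ℂ) (x : β × β → ℂ) :
    ‖WithLp.toLp 2 (fun r : (α × β) × (α × β) => σ r.1.1 r.2.1 * x (r.1.2, r.2.2))‖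
      = frobNorm σ * ‖WithLp.toLp 2 x‖ := by
  have hσ : 0 ≤ frobNorm σ := Real.sqrt_nonneg _
  rw [← sq_eq_sq₀ (norm_nonneg _) (by positivity), mul_pow, frobNorm_sq,
    EuclideanSpace.norm_sq_eq, EuclideanSpace.norm_sq_eq]
  simp only [Fintype.sum_prod_type, norm_mul, mul_pow, Finset.sum_mul]
  refine Finset.sum_congr rfl fun a _ => ?_
  rw [Finset.sum_comm]
  simp only [Finset.mul_sum]

/-- Contracting the doubled first index with the identity costs a factor `√|α|` in norm. -/
theorem norm_doubled_contraction_le {α β : Type*} [Fintype α] [Fintype β]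
    (w : (α × β) × (α × β) → ℂ) :
    ‖WithLp.toLp 2 (fun p : β × β => ∑ i, w ((i, p.1), (i, p.2)))‖
      ≤ √(Fintype.card α) * ‖WithLp.toLp 2 w‖ := by
  rw [← sq_le_sq₀ (norm_nonneg _) (by positivity), mul_pow, Real.sq_sqrt (by positivity),
    EuclideanSpace.norm_sq_eq, EuclideanSpace.norm_sq_eq]
  have hdiag : ∑ p : β × β, ∑ i, ‖w ((i, p.1), (i, p.2))‖ ^ 2 ≤ ∑ r, ‖w r‖ ^ 2 := by
    rw [← Fintype.sum_prod_type' fun (p : β × β) (i : α) => ‖w ((i, p.1), (i, p.2))‖ ^ 2]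
    let e : (β × β) × α ↪ (α × β) × (α × β) :=
      ⟨fun q => ((q.2, q.1.1), (q.2, q.1.2)), fun q r h => by
        simp only [Prod.mk.injEq] at h
        exact Prod.ext (Prod.ext h.1.2 h.2.2) h.1.1⟩
    exact (Finset.sum_map Finset.univ e fun r => ‖w r‖ ^ 2).symm.trans_le
      (Finset.sum_le_univ_sum_of_nonneg fun r => by positivity)
  calc ∑ p : β × β, ‖∑ i, w ((i, p.1), (i, p.2))‖ ^ 2
      ≤ ∑ p : β × β, (Fintype.card α : ℝ) * ∑ i, ‖w ((i, p.1), (i, p.2))‖ ^ 2 := by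
        refine Finset.sum_le_sum fun p _ => ?_
        exact (pow_le_pow_left₀ (norm_nonneg _) (norm_sum_le _ _) 2).trans
          sq_sum_le_card_mul_sum_sq
    _ = Fintype.card α * ∑ p : β × β, ∑ i, ‖w ((i, p.1), (i, p.2))‖ ^ 2 := by
        rw [Finset.mul_sum]
    _ ≤ _ := by gcongr

theorem stmt_9 {d₁ d₂ : ℕ} (hd₁ : 1 ≤ d₁) (hd₂ : 1 ≤ d₂)
    (T : Matrix ((Fin d₁ × Fin d₂) × (Fin d₁ × Fin d₂))
      ((Fin d₁ × Fin d₂) × (Fin d₁ × Fin d₂)) ℂ)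
    (σ : Matrix (Fin d₁) (Fin d₁) ℂ) :
    opNorm (Matrix.of fun p q : Fin d₂ × Fin d₂ =>
        ∑ i : Fin d₁, ∑ a : Fin d₁, ∑ a' : Fin d₁,
          T ((i, p.1), (i, p.2)) ((a, q.1), (a', q.2)) * σ a a')
      ≤ Real.sqrt (d₁ : ℝ) * frobNorm σ * opNorm T := by
  have hσ : 0 ≤ frobNorm σ := Real.sqrt_nonneg _
  have hT : 0 ≤ opNorm T := norm_nonneg _
  refine opNorm_le_of_norm_mulVec_le _ (by positivity) fun x => ?_
  set z : (Fin d₁ × Fin d₂) × (Fin d₁ × Fin d₂) → ℂ :=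
    fun r => σ r.1.1 r.2.1 * x (r.1.2, r.2.2) with hz
  have hB : (Matrix.of fun p q : Fin d₂ × Fin d₂ =>
        ∑ i : Fin d₁, ∑ a : Fin d₁, ∑ a' : Fin d₁,
          T ((i, p.1), (i, p.2)) ((a, q.1), (a', q.2)) * σ a a') *ᵥ x
      = fun p => ∑ i, (T *ᵥ z) ((i, p.1), (i, p.2)) := by
    funext p
    simp only [Matrix.mulVec, dotProduct, Matrix.of_apply, Finset.sum_mul, hz]
    rw [Finset.sum_comm]
    refine Finset.sum_congr rfl fun i _ => ?_
    rw [Finset.sum_comm]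
    simp only [Fintype.sum_prod_type]
    refine Finset.sum_congr rfl fun a _ => Finset.sum_congr rfl fun b _ => ?_
    rw [Finset.sum_comm]
    simp only [mul_assoc]
  rw [hB]
  calc _ ≤ √(d₁ : ℝ) * ‖WithLp.toLp 2 (T *ᵥ z)‖ := by
        simpa using norm_doubled_contraction_le (T *ᵥ z)
    _ ≤ √(d₁ : ℝ) * (opNorm T * ‖WithLp.toLp 2 z‖) := by
        gcongr
        exact norm_mulVec_le_opNorm T z
    _ = √(d₁ : ℝ) * frobNorm σ * opNorm T * ‖WithLp.toLp 2 x‖ := by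
        rw [hz, norm_doubled_tensor]
        ring
end

section
/- Let σ be a positive semidefinite d×d complex matrix with trace 1 (a density operator) with d ≥ 1. Then there exists a positive semidefinite d×d matrix ω with trace 1 such that (1/d) · 1 = (1/(d·‖σ‖∞)) · σ + (1 - 1/(d·‖σ‖∞)) · ω, where 1 denotes the d×d identity matrix. -/
open scoped Matrix ComplexOrder

open scoped Kronecker

open scoped Matrix.Norms.L2Operator MatrixOrder in
theorem Matrix.IsHermitian.posSemidef_opNorm_smul_one_sub {n : Type*} [Fintype n] [DecidableEq n]
    {A : Matrix n n ℂ} (hA : A.IsHermitian) :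
    ((opNorm A : ℂ) • (1 : Matrix n n ℂ) - A).PosSemidef := by
  have h : A ≤ algebraMap ℝ (Matrix n n ℂ) ‖A‖ :=
    IsSelfAdjoint.le_algebraMap_norm_self (ha := hA)
  have hnorm : ‖A‖ = opNorm A := rfl
  rw [Matrix.le_iff, Algebra.algebraMap_eq_smul_one, hnorm] at h
  simpa only [Complex.coe_smul] using h

theorem stmt_11 {d : ℕ} (hd : 1 ≤ d) (σ : Matrix (Fin d) (Fin d) ℂ)
    (hσ : σ.PosSemidef) (htr : σ.trace = 1) :
    ∃ ω : Matrix (Fin d) (Fin d) ℂ, ω.PosSemidef ∧ ω.trace = 1 ∧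
      (1 / (d : ℂ)) • (1 : Matrix (Fin d) (Fin d) ℂ)
        = (1 / ((d : ℂ) * (opNorm σ : ℂ))) • σ
          + ((1 : ℂ) - 1 / ((d : ℂ) * (opNorm σ : ℂ))) • ω := by
  have hpsd := hσ.isHermitian.posSemidef_opNorm_smul_one_sub
  set M := opNorm σ
  have htrace : ((M : ℂ) • (1 : Matrix (Fin d) (Fin d) ℂ) - σ).trace = d * M - 1 := by
    simp [Matrix.trace_sub, Matrix.trace_smul, htr, mul_comm]
  have hd0 : (d : ℂ) ≠ 0 := by exact_mod_cast (by lia : d ≠ 0)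
  have hnonneg : (0 : ℂ) ≤ d * M - 1 := htrace ▸ hpsd.trace_nonneg
  have hM0 : (M : ℂ) ≠ 0 := by
    intro h
    rw [h] at hnonneg
    norm_num [Complex.le_def] at hnonneg
  by_cases hdM : (d : ℂ) * M - 1 = 0
  · refine ⟨σ, hσ, htr, ?_⟩
    have hσM : (M : ℂ) • (1 : Matrix (Fin d) (Fin d) ℂ) = σ :=
      sub_eq_zero.mp (hpsd.trace_eq_zero_iff.mp (htrace.trans hdM))
    have hone : (d : ℂ) * M = 1 := sub_eq_zero.mp hdM
    rw [hone, div_one, one_smul, sub_self, zero_smul, add_zero, ← hσM,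
      eq_div_of_mul_eq hd0 ((mul_comm _ _).trans hone)]
  · refine ⟨((d : ℂ) * M - 1)⁻¹ • ((M : ℂ) • 1 - σ), hpsd.smul (inv_nonneg.mpr hnonneg), ?_, ?_⟩
    · rw [Matrix.trace_smul, htrace, smul_eq_mul, inv_mul_cancel₀ hdM]
    · have hcoef : ((1 : ℂ) - 1 / ((d : ℂ) * M)) * ((d : ℂ) * M - 1)⁻¹ =
          1 / ((d : ℂ) * M) := by
        field_simp
      rw [smul_smul, hcoef, smul_sub, add_sub_cancel, smul_smul]
      congr 1
      field_simp
end

section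
/- (The group-average projection removes the interaction.) Let d₁, d₂ ≥ 1, let H₁ be a d₁×d₁ complex matrix, H₂ a d₂×d₂ complex matrix, and H₁₂ a complex matrix indexed by (Fin d₁ × Fin d₂) × (Fin d₁ × Fin d₂) whose partial trace over system 1 vanishes, i.e. Σ_i H₁₂((i, j), (i, j')) = 0 for all j, j'. Set H = H₁ ⊗ 1₂ + 1₁ ⊗ H₂ + H₁₂. For any matrix ρ indexed by (Fin d₁ × Fin d₂) × (Fin d₁ × Fin d₂), define tr₁ρ by (tr₁ρ)(j, j') = Σ_i ρ((i, j), (i, j')) and D(ρ) = (1/d₁) · (1₁ ⊗ tr₁ρ). Then D(H·D(ρ) - D(ρ)·H) = (1/d₁) · (1₁ ⊗ (H₂·(tr₁ρ) - (tr₁ρ)·H₂)). -/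
open scoped Matrix ComplexOrder

open scoped Kronecker

/-- Partial trace over system 1 of an operator on a bipartite system. -/
noncomputable def ptr1 {d₁ d₂ : ℕ}
    (ρ : Matrix (Fin d₁ × Fin d₂) (Fin d₁ × Fin d₂) ℂ) : Matrix (Fin d₂) (Fin d₂) ℂ :=
  Matrix.of fun j j' => ∑ i : Fin d₁, ρ (i, j) (i, j')

/-- The group-average projection: projects system 1 onto the maximally mixed state. -/
noncomputable def Dmap {d₁ d₂ : ℕ}
    (ρ : Matrix (Fin d₁ × Fin d₂) (Fin d₁ × Fin d₂) ℂ) :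
    Matrix (Fin d₁ × Fin d₂) (Fin d₁ × Fin d₂) ℂ :=
  (1 / (d₁ : ℂ)) • ((1 : Matrix (Fin d₁) (Fin d₁) ℂ) ⊗ₖ ptr1 ρ)

theorem ptr1_add {d₁ d₂ : ℕ} (A B : Matrix (Fin d₁ × Fin d₂) (Fin d₁ × Fin d₂) ℂ) :
    ptr1 (A + B) = ptr1 A + ptr1 B := by
  ext j j'
  simp [ptr1, Finset.sum_add_distrib]

theorem ptr1_sub {d₁ d₂ : ℕ} (A B : Matrix (Fin d₁ × Fin d₂) (Fin d₁ × Fin d₂) ℂ) :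
    ptr1 (A - B) = ptr1 A - ptr1 B := by
  ext j j'
  simp [ptr1]

theorem ptr1_smul {d₁ d₂ : ℕ} (c : ℂ) (A : Matrix (Fin d₁ × Fin d₂) (Fin d₁ × Fin d₂) ℂ) :
    ptr1 (c • A) = c • ptr1 A := by
  ext j j'
  simp [ptr1, Finset.mul_sum]

theorem ptr1_kronecker {d₁ d₂ : ℕ} (A : Matrix (Fin d₁) (Fin d₁) ℂ)
    (B : Matrix (Fin d₂) (Fin d₂) ℂ) : ptr1 (A ⊗ₖ B) = A.trace • B := by
  ext j j'
  simp [ptr1, Matrix.trace, Finset.sum_mul]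

theorem ptr1_mul_one_kronecker {d₁ d₂ : ℕ} (A : Matrix (Fin d₁ × Fin d₂) (Fin d₁ × Fin d₂) ℂ)
    (B : Matrix (Fin d₂) (Fin d₂) ℂ) :
    ptr1 (A * ((1 : Matrix (Fin d₁) (Fin d₁) ℂ) ⊗ₖ B)) = ptr1 A * B := by
  ext j j'
  simp only [ptr1, Matrix.of_apply, Matrix.mul_apply, Fintype.sum_prod_type,
    Matrix.kroneckerMap_apply, Matrix.one_apply, Finset.sum_mul, ite_mul, one_mul, zero_mul, mul_ite, mul_zero]
  rw [Finset.sum_comm (s := (Finset.univ : Finset (Fin d₂)))]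
  refine Finset.sum_congr rfl fun i _ => ?_
  rw [Finset.sum_comm]
  simp

theorem ptr1_one_kronecker_mul {d₁ d₂ : ℕ} (A : Matrix (Fin d₁ × Fin d₂) (Fin d₁ × Fin d₂) ℂ)
    (B : Matrix (Fin d₂) (Fin d₂) ℂ) :
    ptr1 (((1 : Matrix (Fin d₁) (Fin d₁) ℂ) ⊗ₖ B) * A) = B * ptr1 A := by
  ext j j'
  simp only [ptr1, Matrix.of_apply, Matrix.mul_apply, Fintype.sum_prod_type,
    Matrix.kroneckerMap_apply, Matrix.one_apply, Finset.mul_sum, ite_mul, one_mul, zero_mul]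
  rw [Finset.sum_comm (s := (Finset.univ : Finset (Fin d₂)))]
  refine Finset.sum_congr rfl fun i _ => ?_
  rw [Finset.sum_comm]
  simp

theorem stmt_13 {d₁ d₂ : ℕ} (hd₁ : 1 ≤ d₁) (hd₂ : 1 ≤ d₂)
    (H₁ : Matrix (Fin d₁) (Fin d₁) ℂ) (H₂ : Matrix (Fin d₂) (Fin d₂) ℂ)
    (H₁₂ : Matrix (Fin d₁ × Fin d₂) (Fin d₁ × Fin d₂) ℂ)
    (hH₁₂ : ∀ j j' : Fin d₂, ∑ i : Fin d₁, H₁₂ (i, j) (i, j') = 0)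
    (ρ : Matrix (Fin d₁ × Fin d₂) (Fin d₁ × Fin d₂) ℂ) :
    Dmap ((H₁ ⊗ₖ (1 : Matrix (Fin d₂) (Fin d₂) ℂ)
            + (1 : Matrix (Fin d₁) (Fin d₁) ℂ) ⊗ₖ H₂ + H₁₂) * Dmap ρ
        - Dmap ρ * (H₁ ⊗ₖ (1 : Matrix (Fin d₂) (Fin d₂) ℂ)
            + (1 : Matrix (Fin d₁) (Fin d₁) ℂ) ⊗ₖ H₂ + H₁₂))
      = (1 / (d₁ : ℂ)) •
          ((1 : Matrix (Fin d₁) (Fin d₁) ℂ) ⊗ₖ (H₂ * ptr1 ρ - ptr1 ρ * H₂)) := by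
  have hd : (d₁ : ℂ) ≠ 0 := by
    exact_mod_cast (by lia : d₁ ≠ 0)
  have h₁₂ : ptr1 H₁₂ = 0 := by
    ext j j'
    exact hH₁₂ j j'
  have hH : ptr1 (H₁ ⊗ₖ (1 : Matrix (Fin d₂) (Fin d₂) ℂ)
      + (1 : Matrix (Fin d₁) (Fin d₁) ℂ) ⊗ₖ H₂ + H₁₂)
      = H₁.trace • (1 : Matrix (Fin d₂) (Fin d₂) ℂ) + (d₁ : ℂ) • H₂ := by
    simp [ptr1_add, ptr1_kronecker, h₁₂]
  unfold Dmap
  congr 2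
  rw [Matrix.mul_smul, Matrix.smul_mul, ptr1_sub, ptr1_smul, ptr1_smul,
    ptr1_mul_one_kronecker, ptr1_one_kronecker_mul, hH, ← smul_sub, add_mul, mul_add]
  simp only [Matrix.smul_mul, Matrix.mul_smul, one_mul, mul_one, add_sub_add_left_eq_sub]
  rw [← smul_sub, smul_smul, one_div_mul_cancel hd, one_smul]
end

section
/- Let K be a finite index type, let (E_k)_{k ∈ K} be d×d complex matrices and (λ_k)_{k ∈ K} nonnegative reals with tr(E_k† · E_l) = d·λ_k if k = l and 0 otherwise, and Σ_k λ_k = 1. Set P = Σ_k λ_k². Then for every unitary d×d matrix U, ‖Σ_k E_k ⊗ conj(E_k) - U ⊗ conj(U)‖₂ ≥ d · (1 - √P). -/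
open scoped Matrix ComplexOrder

open scoped Kronecker

section FrobeniusNorm

attribute [local instance] Matrix.frobeniusNormedAddCommGroup

theorem frobNorm_eq_norm {m n : Type*} [Fintype m] [Fintype n] (A : Matrix m n ℂ) :
    frobNorm A = ‖A‖ := by
  rw [frobNorm, Matrix.frobenius_norm_def, Real.sqrt_eq_rpow, Finset.sum_comm]
  congr 1
  simp only [Matrix.trace, Matrix.diag_apply, Matrix.mul_apply, Matrix.conjTranspose_apply,
    Complex.re_sum]
  refine Finset.sum_congr rfl fun i _ => Finset.sum_congr rfl fun j _ => ?_
  rw [Complex.star_def, Complex.conj_mul', Real.rpow_two]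
  norm_cast

theorem frobNorm_sub_frobNorm_le {m n : Type*} [Fintype m] [Fintype n] (A B : Matrix m n ℂ) :
    frobNorm B - frobNorm A ≤ frobNorm (A - B) := by
  simp only [frobNorm_eq_norm]
  rw [norm_sub_rev]
  exact norm_sub_norm_le B A

end FrobeniusNorm

theorem trace_conjTranspose_mul_kronecker_conj {n : Type*} [Fintype n] (A B : Matrix n n ℂ) :
    Matrix.trace ((A ⊗ₖ A.map (starRingEnd ℂ))ᴴ * (B ⊗ₖ B.map (starRingEnd ℂ)))
      = Matrix.trace (Aᴴ * B) * starRingEnd ℂ (Matrix.trace (Aᴴ * B)) := by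
  rw [Matrix.conjTranspose_kronecker, ← Matrix.mul_kronecker_mul, Matrix.trace_kronecker]
  congr 1
  simp [Matrix.trace, Matrix.mul_apply]

theorem stmt_14 {d : ℕ} {K : Type*} [Fintype K] [DecidableEq K]
    (E : K → Matrix (Fin d) (Fin d) ℂ) (lam : K → ℝ) (hlam : ∀ k, 0 ≤ lam k)
    (horth : ∀ k l, Matrix.trace ((E k)ᴴ * E l)
      = if k = l then (d : ℂ) * (lam k : ℂ) else 0)
    (hsum : ∑ k, lam k = 1)
    (U : Matrix (Fin d) (Fin d) ℂ) (hU : U ∈ Matrix.unitaryGroup (Fin d) ℂ) :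
    (d : ℝ) * (1 - Real.sqrt (∑ k, lam k ^ 2))
      ≤ frobNorm (∑ k, E k ⊗ₖ (E k).map (starRingEnd ℂ)
          - U ⊗ₖ U.map (starRingEnd ℂ)) := by
  have hdU : frobNorm (U ⊗ₖ U.map (starRingEnd ℂ)) = d := by
    have hUU : Uᴴ * U = 1 := (Matrix.mem_unitaryGroup_iff').mp hU
    rw [frobNorm, trace_conjTranspose_mul_kronecker_conj, hUU]
    simp
  have hdE : frobNorm (∑ k, E k ⊗ₖ (E k).map (starRingEnd ℂ))
      = d * Real.sqrt (∑ k, lam k ^ 2) := by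
    have htrace : Matrix.trace ((∑ k, E k ⊗ₖ (E k).map (starRingEnd ℂ))ᴴ
        * ∑ k, E k ⊗ₖ (E k).map (starRingEnd ℂ)) = (((d : ℝ) ^ 2 * ∑ k, lam k ^ 2 : ℝ) : ℂ) := by
      simp only [Matrix.conjTranspose_sum, Finset.sum_mul_sum, Matrix.trace_sum,
        trace_conjTranspose_mul_kronecker_conj, horth]
      simp [Finset.mul_sum, mul_pow, ← pow_two]
    rw [frobNorm, htrace, Complex.ofReal_re, Real.sqrt_mul (by positivity),
      Real.sqrt_sq (by positivity)]
  have h := frobNorm_sub_frobNorm_le (∑ k, E k ⊗ₖ (E k).map (starRingEnd ℂ))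
    (U ⊗ₖ U.map (starRingEnd ℂ))
  rw [hdU, hdE] at h
  linarith
end

section
/- Let E be a d×d complex matrix such that 1 - E†·E is positive semidefinite, and let λ be a real number with tr(E†·E) = d·λ. Then there exists a unitary d×d matrix U such that ‖E ⊗ conj(E) - U ⊗ conj(U)‖₂² ≤ d² · (1 - λ²). -/
open scoped Matrix ComplexOrder

open scoped Kronecker

/-- A square matrix with mutually orthogonal columns factors through a unitary matrix whose
columns are the normalized columns of the given matrix. -/
theorem exists_unitary_diag_of_conjTranspose_mul_self_eq_diagonal {n : Type*} [Fintype n]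
    [DecidableEq n] (M : Matrix n n ℂ) (D : n → ℝ)
    (hM : Mᴴ * M = Matrix.diagonal (fun i => (D i : ℂ))) :
    ∃ B ∈ Matrix.unitaryGroup n ℂ, ∀ i, (Bᴴ * M) i i = (√(D i) : ℂ) := by
  let w : n → EuclideanSpace ℂ n := fun i => WithLp.toLp 2 (fun k => M k i)
  have hw : ∀ i j, inner ℂ (w i) (w j) = if i = j then (D i : ℂ) else 0 := by
    intro i j
    have h := congrFun (congrFun hM i) j
    rw [Matrix.diagonal_apply] at h
    rw [← h, Matrix.mul_apply, PiLp.inner_apply]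
    exact Finset.sum_congr rfl fun k _ => by simp [w, mul_comm]
  have hD : ∀ i, 0 ≤ D i := by
    intro i
    have h : 0 ≤ RCLike.re (inner ℂ (w i) (w i)) := inner_self_nonneg
    rw [hw, if_pos rfl] at h
    exact h
  let s : Set n := {i | D i ≠ 0}
  let u : n → EuclideanSpace ℂ n := fun i => ((√(D i) : ℝ) : ℂ)⁻¹ • w i
  have hu : Orthonormal ℂ (s.domRestrict u) := by
    rw [orthonormal_iff_ite]
    rintro ⟨i, hi⟩ ⟨j, hj⟩
    simp only [Set.domRestrict_apply, u, inner_smul_left, inner_smul_right, hw, Subtype.mk.injEq]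
    split_ifs with hij
    · subst hij
      have h1 : √(D i) ≠ 0 := (Real.sqrt_ne_zero (hD i)).2 hi
      have h2 : ((√(D i) : ℝ) : ℂ) ≠ 0 := by exact_mod_cast h1
      have h3 : (D i : ℂ) = (√(D i) : ℂ) * (√(D i) : ℂ) := by
        exact_mod_cast (Real.mul_self_sqrt (hD i)).symm
      rw [map_inv₀, Complex.conj_ofReal, h3]
      field_simp
    · simp
  obtain ⟨b, hb⟩ := hu.exists_orthonormalBasis_extension_of_card_eq (by simp)
  refine ⟨Matrix.of fun k i => b i k, ?_, fun i => ?_⟩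
  · rw [Matrix.mem_unitaryGroup_iff']
    ext i j
    have h := orthonormal_iff_ite.1 b.orthonormal i j
    rw [Matrix.one_apply, ← h, Matrix.star_eq_conjTranspose, Matrix.mul_apply, PiLp.inner_apply]
    exact Finset.sum_congr rfl fun k _ => by simp [mul_comm]
  · have h : ((Matrix.of fun k i => b i k)ᴴ * M) i i = inner ℂ (b i) (w i) := by
      rw [Matrix.mul_apply, PiLp.inner_apply]
      exact Finset.sum_congr rfl fun k _ => by simp [w, mul_comm]
    rw [h]
    by_cases hi : D i = 0
    · have hwi : w i = 0 := by
        rw [← inner_self_eq_zero (𝕜 := ℂ), hw]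
        simp [hi]
      simp [hwi, hi]
    · rw [hb i hi]
      have h1 : √(D i) ≠ 0 := (Real.sqrt_ne_zero (hD i)).2 hi
      have h2 : ((√(D i) : ℝ) : ℂ) ≠ 0 := by exact_mod_cast h1
      have h3 : (D i : ℂ) = (√(D i) : ℂ) * (√(D i) : ℂ) := by
        exact_mod_cast (Real.mul_self_sqrt (hD i)).symm
      simp only [u, inner_smul_left, hw, if_true]
      rw [map_inv₀, Complex.conj_ofReal, h3]
      field_simp

/-- A contraction `E` has a unitary `U` with `tr (UᴴE) = tr |E| ≥ tr |E|²`. -/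
theorem exists_unitary_trace_conjTranspose_mul_ge {n : Type*} [Fintype n] [DecidableEq n]
    (E : Matrix n n ℂ) (hE : (1 - Eᴴ * E).PosSemidef) :
    ∃ U ∈ Matrix.unitaryGroup n ℂ, ∃ t : ℝ,
      (Uᴴ * E).trace = (t : ℂ) ∧ (Eᴴ * E).trace.re ≤ t := by
  have hH : (Eᴴ * E).IsHermitian := Matrix.isHermitian_conjTranspose_mul_self E
  let V : Matrix n n ℂ := hH.eigenvectorUnitary
  have hV : Vᴴ * V = 1 := Matrix.mem_unitaryGroup_iff'.1 hH.eigenvectorUnitary.2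
  have hV' : V * Vᴴ = 1 := Matrix.mem_unitaryGroup_iff.1 hH.eigenvectorUnitary.2
  have hdiag : Vᴴ * (Eᴴ * E) * V = Matrix.diagonal (fun i => (hH.eigenvalues i : ℂ)) := by
    have h : Eᴴ * E = V * Matrix.diagonal (fun i => (hH.eigenvalues i : ℂ)) * Vᴴ :=
      hH.spectral_theorem
    generalize Matrix.diagonal (fun i => (hH.eigenvalues i : ℂ)) = D at h ⊢
    rw [h]
    calc Vᴴ * (V * D * Vᴴ) * V = (Vᴴ * V) * D * (Vᴴ * V) := by simp only [Matrix.mul_assoc]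
      _ = D := by simp [hV]
  have hle : ∀ i, hH.eigenvalues i ≤ 1 := by
    intro i
    have h := (hE.conjTranspose_mul_mul_same V).diag_nonneg (i := i)
    rw [Matrix.mul_sub, Matrix.sub_mul, Matrix.mul_one, hV, hdiag] at h
    simp only [Matrix.sub_apply, Matrix.one_apply_eq, Matrix.diagonal_apply_eq] at h
    have h' : (0 : ℂ) ≤ ((1 - hH.eigenvalues i : ℝ) : ℂ) := by simpa using h
    linarith [Complex.zero_le_real.1 h']
  obtain ⟨B, hB, hBd⟩ := exists_unitary_diag_of_conjTranspose_mul_self_eq_diagonal (E * V)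
    hH.eigenvalues (by rw [← hdiag, Matrix.conjTranspose_mul]; simp only [Matrix.mul_assoc])
  refine ⟨B * Vᴴ, mul_mem hB (Unitary.star_mem hH.eigenvectorUnitary.2),
    ∑ i, √(hH.eigenvalues i), ?_, ?_⟩
  · rw [Matrix.conjTranspose_mul, Matrix.conjTranspose_conjTranspose, Matrix.mul_assoc,
      Matrix.trace_mul_comm, Matrix.mul_assoc, Matrix.trace]
    simp [Matrix.diag, hBd]
  · rw [hH.trace_eq_sum_eigenvalues]
    simp only [Complex.coe_algebraMap, Complex.re_sum, Complex.ofReal_re]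
    refine Finset.sum_le_sum fun i _ => Real.le_sqrt_of_sq_le ?_
    have h0 : 0 ≤ hH.eigenvalues i :=
      (Matrix.posSemidef_conjTranspose_mul_self E).eigenvalues_nonneg i
    nlinarith [hle i]

/-- The Hilbert–Schmidt pairing of `A ⊗ conj A` with `B ⊗ conj B`. -/
theorem trace_kronecker_conj_conjTranspose_mul {n : Type*} [Fintype n] (A B : Matrix n n ℂ) :
    ((A ⊗ₖ A.map (starRingEnd ℂ))ᴴ * (B ⊗ₖ B.map (starRingEnd ℂ))).trace
      = (Aᴴ * B).trace * starRingEnd ℂ (Aᴴ * B).trace := by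
  rw [Matrix.conjTranspose_kronecker, ← Matrix.mul_kronecker_mul, Matrix.trace_kronecker]
  congr 1
  simp [Matrix.trace, Matrix.mul_apply]

theorem stmt_15 {d : ℕ} (E : Matrix (Fin d) (Fin d) ℂ)
    (hE : ((1 : Matrix (Fin d) (Fin d) ℂ) - Eᴴ * E).PosSemidef)
    (lam : ℝ) (hlam : Matrix.trace (Eᴴ * E) = (d : ℂ) * (lam : ℂ)) :
    ∃ U : Matrix (Fin d) (Fin d) ℂ, U ∈ Matrix.unitaryGroup (Fin d) ℂ ∧
      frobNorm (E ⊗ₖ E.map (starRingEnd ℂ) - U ⊗ₖ U.map (starRingEnd ℂ)) ^ 2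
        ≤ (d : ℝ) ^ 2 * (1 - lam ^ 2) := by
  obtain ⟨U, hU, t, ht, hle⟩ := exists_unitary_trace_conjTranspose_mul_ge E hE
  refine ⟨U, hU, ?_⟩
  have hUU : (Uᴴ * U).trace = (d : ℂ) := by
    rw [← Matrix.star_eq_conjTranspose, Matrix.mem_unitaryGroup_iff'.1 hU]
    simp
  have hEU : (Eᴴ * U).trace = (t : ℂ) := by
    have h : Eᴴ * U = (Uᴴ * E)ᴴ := by simp
    rw [h, Matrix.trace_conjTranspose, ht]
    exact Complex.conj_ofReal t
  have hle' : (d : ℝ) * lam ≤ t := by simpa [hlam] using hle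
  have h0 : 0 ≤ (d : ℝ) * lam := by
    have h := (Matrix.posSemidef_conjTranspose_mul_self E).trace_nonneg
    rw [hlam] at h
    exact_mod_cast h
  have htr : ((E ⊗ₖ E.map (starRingEnd ℂ) - U ⊗ₖ U.map (starRingEnd ℂ))ᴴ *
      (E ⊗ₖ E.map (starRingEnd ℂ) - U ⊗ₖ U.map (starRingEnd ℂ))).trace
      = (((d * lam) ^ 2 + d ^ 2 - 2 * t ^ 2 : ℝ) : ℂ) := by
    simp only [Matrix.conjTranspose_sub, Matrix.sub_mul, Matrix.mul_sub, Matrix.trace_sub,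
      trace_kronecker_conj_conjTranspose_mul, hlam, hUU, ht, hEU, map_mul, Complex.conj_ofReal,
      Complex.conj_natCast]
    push_cast
    ring
  have hnn := (Matrix.posSemidef_conjTranspose_mul_self
    (E ⊗ₖ E.map (starRingEnd ℂ) - U ⊗ₖ U.map (starRingEnd ℂ))).trace_nonneg
  rw [htr] at hnn
  rw [frobNorm, htr, Complex.ofReal_re, Real.sq_sqrt (Complex.zero_le_real.1 hnn)]
  nlinarith
end
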